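/- If a real binary quartic p has a definite (positive or negative definite) quadratic factor, then the signature of p equals the signature of its catalecticant quadratic form H_p; if p ≠ ±ℓ^4 splits into four real linear factors, then its signature is (2,2). -/

import Mathlib

open MvPolynomial

/-- An honest representation of `p` as a linear combination of `2s`-th powers of
pairwise non-proportional real binary linear forms. -/
def IsHonestRep (s r : ℕ) (p : MvPolynomial (Fin 2) ℝ)
    (lam α β : Fin r → ℝ) : Prop :=
  (∀ k, lam k ≠ 0) ∧
  (∀ k l, k ≠ l → α k * β l - α l * β k ≠ 0) ∧
  p = ∑ k : Fin r, lam k • (α k • X 0 + β k • X 1 : MvPolynomial (Fin 2) ℝ) ^ (2*s)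

/-- The set of badges `(a,b)` of honest representations of `p`, where `a` counts
positive and `b` negative coefficients. -/
def badges (s : ℕ) (p : MvPolynomial (Fin 2) ℝ) : Set (ℕ × ℕ) :=
  { ab | ∃ (r : ℕ) (lam α β : Fin r → ℝ), IsHonestRep s r p lam α β ∧
      ab.1 = Nat.card {k : Fin r // 0 < lam k} ∧
      ab.2 = Nat.card {k : Fin r // lam k < 0} }

/-- A signature of `p` is a minimal badge under the componentwise order. -/
def IsSignature (s : ℕ) (p : MvPolynomial (Fin 2) ℝ) (ab : ℕ × ℕ) : Prop :=
  ab ∈ badges s p ∧ ∀ cd ∈ badges s p, cd.1 ≤ ab.1 → cd.2 ≤ ab.2 → cd = ab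


/-- The quadratic identity underlying Sylvester's law of inertia: a diagonal form in independent
coordinates has at most as many positive coefficients as any other sum-of-squares expression. -/
lemma card_pos_le_of_sum_sq_eq {V ι κ : Type*} [AddCommGroup V] [Module ℝ V] [Fintype ι]
    [Fintype κ] (f : V →ₗ[ℝ] ι → ℝ) (hf : Function.Surjective f) (g : V →ₗ[ℝ] κ → ℝ)
    (μ : ι → ℝ) (lam : κ → ℝ)
    (h : ∀ x, ∑ i, μ i * f x i ^ 2 = ∑ k, lam k * g x k ^ 2) :
    Nat.card {i // 0 < μ i} ≤ Nat.card {k // 0 < lam k} := by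
  classical
  obtain ⟨s, hs⟩ := f.exists_rightInverse_of_surjective (LinearMap.range_eq_top.2 hf)
  let e : ({i // 0 < μ i} → ℝ) →ₗ[ℝ] ι → ℝ :=
    Function.ExtendByZero.linearMap ℝ (Subtype.val : {i // 0 < μ i} → ι)
  have he : ∀ y (i : {i // 0 < μ i}), e y i = y i := fun y i =>
    Subtype.val_injective.extend_apply _ _ _
  have he0 : ∀ y i, ¬ 0 < μ i → e y i = 0 := fun y i hi => by
    refine Function.extend_apply' _ _ _ ?_
    rintro ⟨j, rfl⟩
    exact hi j.2
  let T : ({i // 0 < μ i} → ℝ) →ₗ[ℝ] ({k // 0 < lam k} → ℝ) :=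
    (LinearMap.funLeft ℝ ℝ Subtype.val) ∘ₗ g ∘ₗ s ∘ₗ e
  have hT : Function.Injective T := by
    rw [← LinearMap.ker_eq_bot, LinearMap.ker_eq_bot']
    intro y hy
    have hfs : f (s (e y)) = e y := LinearMap.congr_fun hs (e y)
    have h1 := h (s (e y))
    rw [hfs] at h1
    have h2 : ∑ k, lam k * g (s (e y)) k ^ 2 ≤ 0 := by
      refine Finset.sum_nonpos fun k _ => ?_
      by_cases hk : 0 < lam k
      · have : g (s (e y)) k = 0 := congrFun hy ⟨k, hk⟩
        simp [this]
      · exact mul_nonpos_of_nonpos_of_nonneg (not_lt.1 hk) (sq_nonneg _)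
    have h3 : ∀ i ∈ Finset.univ, 0 ≤ μ i * e y i ^ 2 := by
      intro i _
      by_cases hi : 0 < μ i
      · positivity
      · simp [he0 y i hi]
    have h4 := (Finset.sum_eq_zero_iff_of_nonneg h3).1
      (le_antisymm (h1 ▸ h2) (Finset.sum_nonneg h3))
    ext i
    have h5 := h4 i (Finset.mem_univ _)
    rw [he] at h5
    simpa [i.2.ne'] using h5
  have := LinearMap.finrank_le_finrank_of_injective hT
  simpa [Nat.card_eq_fintype_card] using this

lemma card_neg_le_of_sum_sq_eq {V ι κ : Type*} [AddCommGroup V] [Module ℝ V] [Fintype ι]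
    [Fintype κ] (f : V →ₗ[ℝ] ι → ℝ) (hf : Function.Surjective f) (g : V →ₗ[ℝ] κ → ℝ)
    (μ : ι → ℝ) (lam : κ → ℝ)
    (h : ∀ x, ∑ i, μ i * f x i ^ 2 = ∑ k, lam k * g x k ^ 2) :
    Nat.card {i // μ i < 0} ≤ Nat.card {k // lam k < 0} := by
  simpa using card_pos_le_of_sum_sq_eq f hf g (-μ) (-lam) fun x => by simp [h]

lemma Matrix.IsHermitian.exists_eigenvalue_coordinates {n : Type*} [Fintype n] [DecidableEq n]
    {A : Matrix n n ℝ} (hA : A.IsHermitian) :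
    ∃ f : (n → ℝ) →ₗ[ℝ] n → ℝ, Function.Surjective f ∧
      ∀ x, x ⬝ᵥ A.mulVec x = ∑ i, hA.eigenvalues i * f x i ^ 2 := by
  set U : Matrix n n ℝ := (hA.eigenvectorUnitary : Matrix n n ℝ) with hU
  have hUU : U.transpose * U = 1 := by
    have := (Matrix.mem_unitaryGroup_iff').1 hA.eigenvectorUnitary.2
    simpa [Matrix.star_eq_conjTranspose] using this
  refine ⟨U.transpose.mulVecLin, fun y => ⟨U.mulVec y, ?_⟩, fun x => ?_⟩
  · rw [Matrix.mulVecLin_apply, Matrix.mulVec_mulVec, hUU, Matrix.one_mulVec]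
  · have hsp : A = U * Matrix.diagonal hA.eigenvalues * U.transpose := by
      have := hA.spectral_theorem
      simpa [Unitary.conjStarAlgAut_apply, Matrix.star_eq_conjTranspose, Function.comp_def]
        using this
    have : x ⬝ᵥ A.mulVec x = (U.transpose.mulVec x) ⬝ᵥ
        (Matrix.diagonal hA.eigenvalues).mulVec (U.transpose.mulVec x) := by
      conv_lhs => rw [hsp]
      rw [← Matrix.mulVec_mulVec, ← Matrix.mulVec_mulVec, Matrix.dotProduct_mulVec,
        Matrix.mulVec_transpose]
    rw [this]
    simp only [dotProduct, Matrix.mulVec_diagonal, Matrix.mulVecLin_apply]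
    exact Finset.sum_congr rfl fun i _ => by ring

lemma quartic_coeffs_eq_zero {c₀ c₁ c₂ c₃ c₄ : ℝ}
    (h : ∀ x : ℝ, c₀ * x ^ 4 + c₁ * x ^ 3 + c₂ * x ^ 2 + c₃ * x + c₄ = 0) :
    c₀ = 0 ∧ c₁ = 0 ∧ c₂ = 0 ∧ c₃ = 0 ∧ c₄ = 0 := by
  have h1 := h 0
  have h2 := h 1
  have h3 := h (-1)
  have h4 := h 2
  have h5 := h (-2)
  norm_num at h1 h2 h3 h4 h5
  refine ⟨?_, ?_, ?_, ?_, ?_⟩ <;> linarith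

/-- The binary quartic form with coefficients `a 0, 4 a 1, 6 a 2, 4 a 3, a 4`. -/
def quarticForm (a : ℕ → ℝ) (x y : ℝ) : ℝ :=
  a 0 * x ^ 4 + 4 * a 1 * x ^ 3 * y + 6 * a 2 * x ^ 2 * y ^ 2 + 4 * a 3 * x * y ^ 3
    + a 4 * y ^ 4

/-- A function of two variables is a combination of fourth powers of linear forms. -/
def IsPowerSum {ι : Type*} [Fintype ι] (F : ℝ → ℝ → ℝ) (lam α β : ι → ℝ) : Prop :=
  ∀ x y, F x y = ∑ k, lam k * (α k * x + β k * y) ^ 4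

/-- The linear forms with the given coefficients are pairwise non-proportional. -/
def PairwiseIndep {ι : Type*} (α β : ι → ℝ) : Prop :=
  ∀ k l, k ≠ l → α k * β l - α l * β k ≠ 0

lemma IsPowerSum.coeff_eq {ι : Type*} [Fintype ι] {a : ℕ → ℝ} {lam α β : ι → ℝ}
    (h : IsPowerSum (quarticForm a) lam α β) {j : ℕ} (hj : j < 5) :
    a j = ∑ k, lam k * (α k ^ (4 - j) * β k ^ j) := by
  have h0 : ∀ x : ℝ,
      (a 0 - ∑ k, lam k * (α k ^ 4 * β k ^ 0)) * x ^ 4 +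
      (4 * (a 1 - ∑ k, lam k * (α k ^ 3 * β k ^ 1))) * x ^ 3 +
      (6 * (a 2 - ∑ k, lam k * (α k ^ 2 * β k ^ 2))) * x ^ 2 +
      (4 * (a 3 - ∑ k, lam k * (α k ^ 1 * β k ^ 3))) * x +
      (a 4 - ∑ k, lam k * (α k ^ 0 * β k ^ 4)) = 0 := by
    intro x
    have h1 := h x 1
    have h2 : ∑ k, lam k * (α k * x + β k * 1) ^ 4 =
        (∑ k, lam k * (α k ^ 4 * β k ^ 0)) * x ^ 4 +
        (∑ k, lam k * (α k ^ 3 * β k ^ 1)) * (4 * x ^ 3) +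
        (∑ k, lam k * (α k ^ 2 * β k ^ 2)) * (6 * x ^ 2) +
        (∑ k, lam k * (α k ^ 1 * β k ^ 3)) * (4 * x) +
        (∑ k, lam k * (α k ^ 0 * β k ^ 4)) := by
      simp only [Finset.sum_mul, ← Finset.sum_add_distrib]
      exact Finset.sum_congr rfl fun k _ => by ring
    rw [h2] at h1
    unfold quarticForm at h1
    linear_combination h1
  obtain ⟨h1, h2, h3, h4, h5⟩ := quartic_coeffs_eq_zero h0
  interval_cases j <;> norm_num at h1 h2 h3 h4 h5 ⊢ <;> linarith

/-- The values at a catalecticant variable of the squares of given linear forms. -/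
def squareEval {ι : Type*} (α β : ι → ℝ) : (Fin 3 → ℝ) →ₗ[ℝ] ι → ℝ where
  toFun x k := α k ^ 2 * x 0 + α k * β k * x 1 + β k ^ 2 * x 2
  map_add' x y := by ext k; simp; ring
  map_smul' c x := by ext k; simp; ring

lemma squareEval_surjective {α β : Fin 3 → ℝ} (h : PairwiseIndep α β) :
    Function.Surjective (squareEval α β) := by
  have h01 := h 0 1 (by decide)
  have h02 := h 0 2 (by decide)
  have h12 := h 1 2 (by decide)
  have h10 : α 1 * β 0 - α 0 * β 1 ≠ 0 := h 1 0 (by decide)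
  intro y
  let v : Fin 3 → Fin 3 → Fin 3 → ℝ := fun i j =>
    ![β i * β j, -(α i * β j + α j * β i), α i * α j]
  have hv : ∀ i j k, squareEval α β (v i j) k =
      (α k * β i - α i * β k) * (α k * β j - α j * β k) := by
    intro i j k
    simp [squareEval, v]
    ring
  have h20 : α 2 * β 0 - α 0 * β 2 ≠ 0 := h 2 0 (by decide)
  have h21 : α 2 * β 1 - α 1 * β 2 ≠ 0 := h 2 1 (by decide)
  refine ⟨(y 0 / ((α 0 * β 1 - α 1 * β 0) * (α 0 * β 2 - α 2 * β 0))) • v 1 2 +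
    (y 1 / ((α 1 * β 0 - α 0 * β 1) * (α 1 * β 2 - α 2 * β 1))) • v 0 2 +
    (y 2 / ((α 2 * β 0 - α 0 * β 2) * (α 2 * β 1 - α 1 * β 2))) • v 0 1, ?_⟩
  ext k
  simp only [map_add, map_smul, Pi.add_apply, Pi.smul_apply, hv, smul_eq_mul]
  fin_cases k
  · simpa using div_mul_cancel₀ (y 0) (mul_ne_zero h01 h02)
  · simpa using div_mul_cancel₀ (y 1) (mul_ne_zero h10 h12)
  · simpa using div_mul_cancel₀ (y 2) (mul_ne_zero h20 h21)

lemma IsPowerSum.hankel_eq {ι : Type*} [Fintype ι] {a : ℕ → ℝ} {lam α β : ι → ℝ}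
    (h : IsPowerSum (quarticForm a) lam α β) {A : Matrix (Fin 3) (Fin 3) ℝ}
    (hA : A = Matrix.of fun i j : Fin 3 => a ((i : ℕ) + (j : ℕ))) (x : Fin 3 → ℝ) :
    x ⬝ᵥ A.mulVec x = ∑ k, lam k * squareEval α β x k ^ 2 := by
  have h1 : x ⬝ᵥ A.mulVec x = a 0 * x 0 ^ 2 + 2 * a 1 * (x 0 * x 1) +
      a 2 * (x 1 ^ 2 + 2 * (x 0 * x 2)) + 2 * a 3 * (x 1 * x 2) + a 4 * x 2 ^ 2 := by
    rw [hA]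
    simp [dotProduct, Matrix.mulVec, Fin.sum_univ_three]
    ring
  rw [h1, h.coeff_eq (j := 0) (by simp), h.coeff_eq (j := 1) (by simp),
    h.coeff_eq (j := 2) (by simp), h.coeff_eq (j := 3) (by simp), h.coeff_eq (j := 4) (by simp)]
  simp only [Finset.sum_mul, Finset.mul_sum, ← Finset.sum_add_distrib]
  refine Finset.sum_congr rfl fun k _ => ?_
  simp [squareEval]
  ring

lemma isPowerSum_of_isHonestRep {r : ℕ} {p : MvPolynomial (Fin 2) ℝ} {lam α β : Fin r → ℝ}
    (h : IsHonestRep 2 r p lam α β) :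
    IsPowerSum (fun x y => eval ![x, y] p) lam α β := by
  intro x y
  simp only
  rw [h.2.2]
  simp [smul_eval]

lemma eq_of_eval_eq {p q : MvPolynomial (Fin 2) ℝ}
    (h : ∀ x y, eval ![x, y] p = eval ![x, y] q) : p = q := by
  refine MvPolynomial.funext fun v => ?_
  have : v = ![v 0, v 1] := by ext i; fin_cases i <;> rfl
  rw [this]
  exact h _ _

lemma mem_badges_of_isPowerSum {ι : Type*} [Fintype ι] {p : MvPolynomial (Fin 2) ℝ}
    {lam α β : ι → ℝ} (hi : PairwiseIndep α β)
    (h : IsPowerSum (fun x y => eval ![x, y] p) lam α β) :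
    (Nat.card {k // 0 < lam k}, Nat.card {k // lam k < 0}) ∈ badges 2 p := by
  classical
  let e := (Fintype.equivFin {k // lam k ≠ 0}).symm
  refine ⟨Fintype.card {k // lam k ≠ 0}, fun i => lam (e i), fun i => α (e i),
    fun i => β (e i), ⟨fun k => (e k).2, fun k l hkl => hi _ _ ?_, ?_⟩, ?_, ?_⟩
  · exact fun hh => hkl (e.injective (Subtype.ext hh))
  · refine eq_of_eval_eq fun x y => ?_
    refine (h x y).trans ?_
    simp only [map_sum, smul_eval, map_pow, map_add, eval_X]
    rw [e.sum_comp (fun k : {k // lam k ≠ 0} => lam k *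
      (α k * (![x, y] : Fin 2 → ℝ) 0 + β k * (![x, y] : Fin 2 → ℝ) 1) ^ (2 * 2))]
    rw [← Finset.sum_subtype (Finset.univ.filter fun k => lam k ≠ 0) (by simp)
      (fun k => lam k *
        (α k * (![x, y] : Fin 2 → ℝ) 0 + β k * (![x, y] : Fin 2 → ℝ) 1) ^ (2 * 2)),
      Finset.sum_filter_of_ne fun k _ hk => left_ne_zero_of_mul hk]
    simp
  · refine Nat.card_congr ((e.subtypeEquiv (p := fun i => 0 < lam (e i))
      (q := fun k : {k // lam k ≠ 0} => 0 < lam k) fun _ => Iff.rfl).trans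
      (Equiv.subtypeSubtypeEquivSubtype
        (p := fun k => lam k ≠ 0) (q := fun k => 0 < lam k) fun hk => ne_of_gt hk)).symm
  · refine Nat.card_congr ((e.subtypeEquiv (p := fun i => lam (e i) < 0)
      (q := fun k : {k // lam k ≠ 0} => lam k < 0) fun _ => Iff.rfl).trans
      (Equiv.subtypeSubtypeEquivSubtype
        (p := fun k => lam k ≠ 0) (q := fun k => lam k < 0) fun hk => ne_of_lt hk)).symm

lemma IsPowerSum.comp_linear {ι : Type*} [Fintype ι] {F : ℝ → ℝ → ℝ} {lam α β : ι → ℝ}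
    (h : IsPowerSum F lam α β) (P Q R S : ℝ) :
    IsPowerSum (fun x y => F (P * x + Q * y) (R * x + S * y)) lam
      (fun k => α k * P + β k * R) (fun k => α k * Q + β k * S) := by
  intro x y
  simp only
  rw [h]
  exact Finset.sum_congr rfl fun k _ => by ring

lemma PairwiseIndep.comp_linear {ι : Type*} {α β : ι → ℝ} (h : PairwiseIndep α β)
    {P Q R S : ℝ} (hd : P * S - Q * R ≠ 0) :
    PairwiseIndep (fun k => α k * P + β k * R) (fun k => α k * Q + β k * S) := by
  intro k l hkl
  have : (α k * P + β k * R) * (α l * Q + β l * S) - (α l * P + β l * R) * (α k * Q + β k * S)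
      = (α k * β l - α l * β k) * (P * S - Q * R) := by ring
  simp only
  rw [this]
  exact mul_ne_zero (h k l hkl) hd

lemma exists_rotation (g₀ g₁ g₂ : ℝ) :
    ∃ C S : ℝ, C ^ 2 + S ^ 2 = 1 ∧ g₁ * (C ^ 2 - S ^ 2) = 2 * (g₀ - g₂) * (C * S) := by
  set z : ℂ := ⟨g₀ - g₂, g₁⟩ with hz
  have h1 := Complex.norm_mul_cos_arg z
  have h2 := Complex.norm_mul_sin_arg z
  have h3 : z.arg = 2 * (z.arg / 2) := by ring
  rw [h3, Real.cos_two_mul'] at h1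
  rw [h3, Real.sin_two_mul] at h2
  simp only [hz] at h1 h2
  refine ⟨Real.cos (z.arg / 2), Real.sin (z.arg / 2), Real.cos_sq_add_sin_sq _, ?_⟩
  rw [← hz] at h1 h2
  rw [← h1]
  conv_lhs => rw [← h2]
  ring

/-- A positive definite binary quadratic form and another binary quadratic form can be
diagonalized simultaneously. -/
lemma exists_simultaneous_diagonalization {b₀ b₁ b₂ : ℝ} (hb₀ : 0 < b₀)
    (hb : b₁ ^ 2 - 4 * b₀ * b₂ < 0) (c₀ c₁ c₂ : ℝ) :
    ∃ P Q R S s t : ℝ, P * S - Q * R ≠ 0 ∧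
      (∀ x y, b₀ * x ^ 2 + b₁ * (x * y) + b₂ * y ^ 2 =
        (P * x + Q * y) ^ 2 + (R * x + S * y) ^ 2) ∧
      ∀ x y, c₀ * x ^ 2 + c₁ * (x * y) + c₂ * y ^ 2 =
        s * (P * x + Q * y) ^ 2 + t * (R * x + S * y) ^ 2 := by
  obtain ⟨k, hk, hk2⟩ : ∃ k : ℝ, 0 < k ∧ b₀ = k ^ 2 :=
    ⟨√b₀, Real.sqrt_pos.2 hb₀, (Real.sq_sqrt hb₀.le).symm⟩
  subst hk2
  have hm0 : 0 < b₂ - (b₁ / (2 * k)) ^ 2 := by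
    have : b₂ - (b₁ / (2 * k)) ^ 2 = -(b₁ ^ 2 - 4 * k ^ 2 * b₂) / (4 * k ^ 2) := by
      field_simp
      ring
    rw [this]
    exact div_pos (neg_pos.2 hb) (by positivity)
  obtain ⟨m, hm, hm2⟩ : ∃ m : ℝ, 0 < m ∧ b₂ = m ^ 2 + (b₁ / (2 * k)) ^ 2 :=
    ⟨√_, Real.sqrt_pos.2 hm0, by rw [Real.sq_sqrt hm0.le]; ring⟩
  obtain ⟨n, rfl⟩ : ∃ n : ℝ, b₁ = 2 * k * n := ⟨b₁ / (2 * k), by field_simp⟩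
  have hn : 2 * k * n / (2 * k) = n := by field_simp
  rw [hn] at hm2
  subst hm2
  obtain ⟨C, S, hCS, hrot⟩ := exists_rotation (c₀ / k ^ 2)
    (c₁ / (k * m) - 2 * c₀ * n / (k ^ 2 * m))
    (c₀ * n ^ 2 / (k * m) ^ 2 - c₁ * n / (k * m ^ 2) + c₂ / m ^ 2)
  set g₀ := c₀ / k ^ 2 with hg₀
  set g₁ := c₁ / (k * m) - 2 * c₀ * n / (k ^ 2 * m) with hg₁
  set g₂ := c₀ * n ^ 2 / (k * m) ^ 2 - c₁ * n / (k * m ^ 2) + c₂ / m ^ 2 with hg₂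
  refine ⟨C * k, C * n + S * m, -S * k, -S * n + C * m,
    g₀ * C ^ 2 + g₁ * (C * S) + g₂ * S ^ 2, g₀ * S ^ 2 - g₁ * (C * S) + g₂ * C ^ 2, ?_, ?_, ?_⟩
  · have : C * k * (-S * n + C * m) - (C * n + S * m) * (-S * k) = k * m := by
      linear_combination k * m * hCS
    rw [this]
    positivity
  · intro x y
    linear_combination (-(k * x + n * y) ^ 2 - (m * y) ^ 2) * hCS
  · intro x y
    have e : c₀ * x ^ 2 + c₁ * (x * y) + c₂ * y ^ 2 =
        g₀ * (k * x + n * y) ^ 2 + g₁ * ((k * x + n * y) * (m * y)) + g₂ * (m * y) ^ 2 := by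
      rw [hg₀, hg₁, hg₂]
      field_simp
      ring
    rw [e]
    rw [show C * k * x + (C * n + S * m) * y = C * (k * x + n * y) + S * (m * y) by ring,
      show -S * k * x + (-S * n + C * m) * y = -S * (k * x + n * y) + C * (m * y) by ring]
    generalize k * x + n * y = U
    generalize m * y = V
    linear_combination
      (-(C * S) * U ^ 2 + C * S * V ^ 2 + (C ^ 2 - S ^ 2) * (U * V)) * hrot -
      (g₀ * U ^ 2 + g₁ * (U * V) + g₂ * V ^ 2) * (C ^ 2 + S ^ 2 + 1) * hCS

lemma exists_three_fourth_powers_aux {u v : ℝ} (huv : 0 < u + v) (hv : 0 < v) :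
    ∃ lam α β : Fin 3 → ℝ, PairwiseIndep α β ∧
      IsPowerSum (fun x y => (x ^ 2 + y ^ 2) * (u * x ^ 2 + v * y ^ 2)) lam α β := by
  have h6 : 0 < 6 * v / (u + v) := by positivity
  obtain ⟨c, hc, hc2⟩ : ∃ c : ℝ, 0 < c ∧ c ^ 2 = 6 * v / (u + v) :=
    ⟨√_, Real.sqrt_pos.2 h6, Real.sq_sqrt h6.le⟩
  have hv' : v = (u + v) / 6 * c ^ 2 := by rw [hc2]; field_simp
  refine ⟨![(u + v) / (12 * c ^ 2), (u + v) / (12 * c ^ 2), u - (u + v) / (6 * c ^ 2)],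
    ![1, 1, 1], ![c, -c, 0], ?_, ?_⟩
  · intro k l hkl
    fin_cases k <;> fin_cases l <;> simp at hkl ⊢ <;> first | positivity | (intro h; linarith)
  · intro x y
    simp only [Fin.sum_univ_three]
    simp
    field_simp
    linear_combination (72 * c ^ 2 * y ^ 4) * hv'

lemma exists_three_fourth_powers (u v : ℝ) :
    ∃ lam α β : Fin 3 → ℝ, PairwiseIndep α β ∧
      IsPowerSum (fun x y => (x ^ 2 + y ^ 2) * (u * x ^ 2 + v * y ^ 2)) lam α β := by
  have key : ∀ u v : ℝ, 0 < u + v → ∃ lam α β : Fin 3 → ℝ, PairwiseIndep α β ∧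
      IsPowerSum (fun x y => (x ^ 2 + y ^ 2) * (u * x ^ 2 + v * y ^ 2)) lam α β := by
    intro u v huv
    by_cases hv : 0 < v
    · exact exists_three_fourth_powers_aux huv hv
    · obtain ⟨lam, α, β, hi, h⟩ := exists_three_fourth_powers_aux (u := v) (v := u)
        (by linarith) (by linarith)
      refine ⟨lam, β, α, fun k l hkl hh => hi k l hkl (by linarith), fun x y => ?_⟩
      have := h y x
      simp only at this ⊢
      rw [show (x ^ 2 + y ^ 2) * (u * x ^ 2 + v * y ^ 2) =
        (y ^ 2 + x ^ 2) * (v * y ^ 2 + u * x ^ 2) by ring, this]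
      exact Finset.sum_congr rfl fun k _ => by ring
  rcases lt_trichotomy (u + v) 0 with h0 | h0 | h0
  · obtain ⟨lam, α, β, hi, h⟩ := key (-u) (-v) (by linarith)
    refine ⟨-lam, α, β, hi, fun x y => ?_⟩
    have := h x y
    simp only [Pi.neg_apply, neg_mul, Finset.sum_neg_distrib] at this ⊢
    linarith
  · refine ⟨![u, v, 0], ![1, 0, 1], ![0, 1, 1], ?_, ?_⟩
    · intro k l hkl
      fin_cases k <;> fin_cases l <;> simp at hkl ⊢
    · intro x y
      simp only [Fin.sum_univ_three]
      simp
      linear_combination x ^ 2 * y ^ 2 * h0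
  · exact key u v h0

lemma exists_three_fourth_powers_of_definite_factor {b₀ b₁ b₂ : ℝ}
    (hb : b₁ ^ 2 - 4 * b₀ * b₂ < 0) (c₀ c₁ c₂ : ℝ) :
    ∃ lam α β : Fin 3 → ℝ, PairwiseIndep α β ∧
      IsPowerSum (fun x y => (b₀ * x ^ 2 + b₁ * (x * y) + b₂ * y ^ 2) *
        (c₀ * x ^ 2 + c₁ * (x * y) + c₂ * y ^ 2)) lam α β := by
  wlog hb₀ : 0 < b₀ generalizing b₀ b₁ b₂ c₀ c₁ c₂
  · have hne : b₀ ≠ 0 := by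
      rintro rfl
      nlinarith [sq_nonneg b₁]
    obtain ⟨lam, α, β, hi, h⟩ := this (b₀ := -b₀) (b₁ := -b₁) (b₂ := -b₂) (by linarith)
      (-c₀) (-c₁) (-c₂) (neg_pos.2 (lt_of_le_of_ne (not_lt.1 hb₀) hne))
    exact ⟨lam, α, β, hi, fun x y => by rw [← h x y]; ring⟩
  obtain ⟨P, Q, R, S, s, t, hd, hbe, hce⟩ := exists_simultaneous_diagonalization hb₀ hb c₀ c₁ c₂
  obtain ⟨lam, α, β, hi, h⟩ := exists_three_fourth_powers s t
  refine ⟨lam, _, _, hi.comp_linear hd, ?_⟩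
  have := h.comp_linear P Q R S
  simpa only [hbe, hce] using this

lemma exists_quadratic_cofactor {a : ℕ → ℝ} {p : MvPolynomial (Fin 2) ℝ}
    (hp : ∀ x y, eval ![x, y] p = quarticForm a x y) {b₀ b₁ b₂ : ℝ}
    (hb : b₁ ^ 2 - 4 * b₀ * b₂ < 0) {q : MvPolynomial (Fin 2) ℝ}
    (hq : p = (b₀ • (X 0 : MvPolynomial (Fin 2) ℝ) ^ 2 + b₁ • (X 0 * X 1) + b₂ • X 1 ^ 2) * q) :
    ∃ c₀ c₁ c₂ : ℝ, ∀ x y, eval ![x, y] p =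
      (b₀ * x ^ 2 + b₁ * (x * y) + b₂ * y ^ 2) * (c₀ * x ^ 2 + c₁ * (x * y) + c₂ * y ^ 2) := by
  have hne : b₀ ≠ 0 := by
    rintro rfl
    nlinarith [sq_nonneg b₁]
  let Q : Polynomial ℝ := aeval ![Polynomial.X, 1] q
  have hQ : ∀ x, Q.eval x = eval ![x, 1] q := by
    intro x
    have : (Polynomial.evalRingHom x).comp
        (aeval (R := ℝ) ![(Polynomial.X : Polynomial ℝ), 1]).toRingHom = eval ![x, 1] := by
      refine MvPolynomial.ringHom_ext (fun r => by simp) fun i => ?_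
      fin_cases i <;> simp
    exact RingHom.congr_fun this q
  let B : Polynomial ℝ := Polynomial.C b₀ * Polynomial.X ^ 2 + Polynomial.C b₁ * Polynomial.X +
    Polynomial.C b₂
  let M : Polynomial ℝ := Polynomial.C (a 0) * Polynomial.X ^ 4 +
    Polynomial.C (4 * a 1) * Polynomial.X ^ 3 + Polynomial.C (6 * a 2) * Polynomial.X ^ 2 +
    Polynomial.C (4 * a 3) * Polynomial.X + Polynomial.C (a 4)
  have hBQ : M = B * Q := by
    refine Polynomial.funext fun x => ?_
    have h1 := hp x 1
    rw [hq] at h1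
    simp [smul_eval] at h1
    simp [M, B, hQ, h1, quarticForm]
  have hM : M.natDegree ≤ 4 := by
    simp only [M]
    compute_degree
  have hB : B.natDegree = 2 := Polynomial.natDegree_quadratic hne
  have hQd : Q.natDegree < 3 := by
    by_cases h0 : Q = 0
    · simp [h0]
    · have : B ≠ 0 := by
        intro h
        simp [h] at hB
      rw [hBQ, Polynomial.natDegree_mul this h0, hB] at hM
      omega
  have hQe : ∀ x, Q.eval x = Q.coeff 2 * x ^ 2 + Q.coeff 1 * x + Q.coeff 0 := by
    intro x
    rw [Polynomial.eval_eq_sum_range' hQd]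
    simp [Finset.sum_range_succ]
    ring
  have hz := quartic_coeffs_eq_zero (c₀ := a 0 - b₀ * Q.coeff 2)
    (c₁ := 4 * a 1 - (b₀ * Q.coeff 1 + b₁ * Q.coeff 2))
    (c₂ := 6 * a 2 - (b₀ * Q.coeff 0 + b₁ * Q.coeff 1 + b₂ * Q.coeff 2))
    (c₃ := 4 * a 3 - (b₁ * Q.coeff 0 + b₂ * Q.coeff 1))
    (c₄ := a 4 - b₂ * Q.coeff 0) (fun x => by
      have h1 := congrArg (Polynomial.eval x) hBQ
      rw [Polynomial.eval_mul, hQe] at h1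
      simp [M, B] at h1
      linear_combination h1)
  obtain ⟨h1, h2, h3, h4, h5⟩ := hz
  refine ⟨Q.coeff 2, Q.coeff 1, Q.coeff 0, fun x y => ?_⟩
  rw [hp, quarticForm]
  linear_combination x ^ 4 * h1 + x ^ 3 * y * h2 + x ^ 2 * y ^ 2 * h3 + x * y ^ 3 * h4 +
    y ^ 4 * h5

theorem isSignature_of_definite_factor {a : ℕ → ℝ} {p : MvPolynomial (Fin 2) ℝ}
    (hp : ∀ x y, eval ![x, y] p = quarticForm a x y) {A : Matrix (Fin 3) (Fin 3) ℝ}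
    (hA : A = Matrix.of fun i j : Fin 3 => a ((i : ℕ) + (j : ℕ))) (hAh : A.IsHermitian)
    {b₀ b₁ b₂ : ℝ} (hb : b₁ ^ 2 - 4 * b₀ * b₂ < 0) {q : MvPolynomial (Fin 2) ℝ}
    (hq : p = (b₀ • (X 0 : MvPolynomial (Fin 2) ℝ) ^ 2 + b₁ • (X 0 * X 1) + b₂ • X 1 ^ 2) * q) :
    IsSignature 2 p
      (Nat.card {i // 0 < hAh.eigenvalues i}, Nat.card {i // hAh.eigenvalues i < 0}) := by
  obtain ⟨f, hf, hfe⟩ := hAh.exists_eigenvalue_coordinates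
  have hpe : (fun x y => eval ![x, y] p) = quarticForm a := by
    ext x y
    exact hp x y
  constructor
  · obtain ⟨c₀, c₁, c₂, hc⟩ := exists_quadratic_cofactor hp hb hq
    obtain ⟨lam, α, β, hi, h⟩ := exists_three_fourth_powers_of_definite_factor hb c₀ c₁ c₂
    simp only [← hc] at h
    have hmem := mem_badges_of_isPowerSum hi h
    rw [hpe] at h
    have hH := h.hankel_eq hA
    have hs := squareEval_surjective hi
    rwa [(card_pos_le_of_sum_sq_eq _ hs f lam _ fun x => by rw [← hH, hfe]).antisymm
        (card_pos_le_of_sum_sq_eq f hf _ _ lam fun x => by rw [← hH, hfe]),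
      (card_neg_le_of_sum_sq_eq _ hs f lam _ fun x => by rw [← hH, hfe]).antisymm
        (card_neg_le_of_sum_sq_eq f hf _ _ lam fun x => by rw [← hH, hfe])] at hmem
  · rintro ⟨c, d⟩ ⟨r, lam, α, β, hrep, rfl, rfl⟩ h1 h2
    have h := isPowerSum_of_isHonestRep hrep
    rw [hpe] at h
    have hH := h.hankel_eq hA
    exact Prod.ext
      (le_antisymm h1 (card_pos_le_of_sum_sq_eq f hf _ _ lam fun x => by rw [← hH, hfe]))
      (le_antisymm h2 (card_neg_le_of_sum_sq_eq f hf _ _ lam fun x => by rw [← hH, hfe]))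

/-- A multiple of the fourth power of a linear form. -/
def IsFourthPower (F : ℝ → ℝ → ℝ) : Prop :=
  ∃ k m n : ℝ, ∀ x y, F x y = k * (m * x + n * y) ^ 4

lemma IsFourthPower.comp_linear {F : ℝ → ℝ → ℝ} (h : IsFourthPower F) (P Q R S : ℝ) :
    IsFourthPower fun x y => F (P * x + Q * y) (R * x + S * y) := by
  obtain ⟨k, m, n, h⟩ := h
  refine ⟨k, m * P + n * R, m * Q + n * S, fun x y => ?_⟩
  simp only
  rw [h]
  ring

lemma exists_ne_zero_of_pos_coeff_subsingleton {ι : Type*} [Fintype ι] {F : ℝ → ℝ → ℝ}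
    {lam α β : ι → ℝ} (hlam : ∀ k, lam k ≠ 0) (hi : PairwiseIndep α β)
    (h : IsPowerSum F lam α β) (hF : ¬ IsFourthPower F)
    (hs : ∀ k l, 0 < lam k → 0 < lam l → k = l) :
    ∃ u v, F u v ≠ 0 ∧ ∀ k, 0 < lam k → α k * u + β k * v = 0 := by
  by_cases hex : ∃ k, 0 < lam k ∧ ¬ (α k = 0 ∧ β k = 0)
  · obtain ⟨k₀, hk₀, -⟩ := hex
    refine ⟨β k₀, -α k₀, fun h0 => ?_, fun k hk => ?_⟩
    · rw [h] at h0
      have hle : ∀ k ∈ Finset.univ, lam k * (α k * β k₀ + β k * -α k₀) ^ 4 ≤ 0 := by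
        intro k _
        by_cases hk : 0 < lam k
        · rw [hs k k₀ hk hk₀]
          apply le_of_eq
          ring
        · exact mul_nonpos_of_nonpos_of_nonneg (not_lt.1 hk) (by positivity)
      have hz := (Finset.sum_eq_zero_iff_of_nonpos hle).1 h0
      have hall : ∀ k, k = k₀ := by
        intro k
        by_contra hne
        have h1 := hz k (Finset.mem_univ k)
        have h2 : (α k * β k₀ + β k * -α k₀) ^ 4 = 0 := by simpa [hlam k] using h1
        have h3 : α k * β k₀ + β k * -α k₀ = 0 := by simpa using h2
        exact hi k k₀ hne (by linarith)
      refine hF ⟨lam k₀, α k₀, β k₀, fun x y => ?_⟩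
      rw [h, Finset.sum_eq_single k₀ (fun k _ hk => absurd (hall k) hk) (by simp)]
    · rw [hs k k₀ hk hk₀]
      ring
  · push Not at hex
    have hne : ∃ u v, F u v ≠ 0 := by
      by_contra! hz
      exact hF ⟨0, 0, 0, fun x y => by simp [hz]⟩
    obtain ⟨u, v, huv⟩ := hne
    refine ⟨u, v, huv, fun k hk => ?_⟩
    obtain ⟨h1, h2⟩ := hex k hk
    simp [h1, h2]

/-- A product of four linear forms whose second polar at some point is non-positive, in terms of
a power sum representation, is a multiple of a fourth power. -/
lemma isFourthPower_of_pos_coeff_vanish {ι : Type*} [Fintype ι] {F : ℝ → ℝ → ℝ}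
    {lam α β : ι → ℝ} (h : IsPowerSum F lam α β) {e f : Fin 4 → ℝ}
    (hF : ∀ x y, F x y = ∏ i, (e i * x + f i * y)) {u v : ℝ} (huv : F u v ≠ 0)
    (hpos : ∀ k, 0 < lam k → α k * u + β k * v = 0) : IsFourthPower F := by
  set m : Fin 4 → ℝ := fun i => e i * u + f i * v with hm
  have hFm : F u v = m 0 * m 1 * m 2 * m 3 := by rw [hF, Fin.prod_univ_four]
  have hpolar : ∀ n : Fin 4 → ℝ, (∃ x y, ∀ i, n i = e i * x + f i * y) →
      m 0 * m 1 * n 2 * n 3 + m 0 * n 1 * m 2 * n 3 + m 0 * n 1 * n 2 * m 3 +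
      n 0 * m 1 * m 2 * n 3 + n 0 * m 1 * n 2 * m 3 + n 0 * n 1 * m 2 * m 3 ≤ 0 := by
    rintro n ⟨x, y, hn⟩
    set d : ι → ℝ := fun k => α k * u + β k * v with hd
    set l : ι → ℝ := fun k => α k * x + β k * y with hl
    obtain ⟨-, -, h2, -, -⟩ := quartic_coeffs_eq_zero
      (c₀ := ∑ k, lam k * l k ^ 4 - n 0 * n 1 * n 2 * n 3)
      (c₁ := 4 * ∑ k, lam k * (d k * l k ^ 3) - (m 0 * n 1 * n 2 * n 3 + n 0 * m 1 * n 2 * n 3 +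
        n 0 * n 1 * m 2 * n 3 + n 0 * n 1 * n 2 * m 3))
      (c₂ := 6 * ∑ k, lam k * (d k ^ 2 * l k ^ 2) -
        (m 0 * m 1 * n 2 * n 3 + m 0 * n 1 * m 2 * n 3 + m 0 * n 1 * n 2 * m 3 +
        n 0 * m 1 * m 2 * n 3 + n 0 * m 1 * n 2 * m 3 + n 0 * n 1 * m 2 * m 3))
      (c₃ := 4 * ∑ k, lam k * (d k ^ 3 * l k) - (n 0 * m 1 * m 2 * m 3 + m 0 * n 1 * m 2 * m 3 +
        m 0 * m 1 * n 2 * m 3 + m 0 * m 1 * m 2 * n 3))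
      (c₄ := ∑ k, lam k * d k ^ 4 - m 0 * m 1 * m 2 * m 3) (fun t => by
        have h1 := h (u + t * x) (v + t * y)
        rw [hF, Fin.prod_univ_four] at h1
        have h2 : ∑ k, lam k * (α k * (u + t * x) + β k * (v + t * y)) ^ 4 =
            (∑ k, lam k * l k ^ 4) * t ^ 4 + (∑ k, lam k * (d k * l k ^ 3)) * (4 * t ^ 3) +
            (∑ k, lam k * (d k ^ 2 * l k ^ 2)) * (6 * t ^ 2) +
            (∑ k, lam k * (d k ^ 3 * l k)) * (4 * t) + ∑ k, lam k * d k ^ 4 := by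
          simp only [Finset.sum_mul, ← Finset.sum_add_distrib]
          exact Finset.sum_congr rfl fun k _ => by simp only [hd, hl]; ring
        have h3 : ∀ i, e i * (u + t * x) + f i * (v + t * y) = m i + t * n i := by
          intro i
          rw [hn]
          simp only [hm]
          ring
        rw [h2] at h1
        simp only [h3] at h1
        linear_combination -h1)
    have h3 : ∑ k, lam k * (d k ^ 2 * l k ^ 2) ≤ 0 := by
      refine Finset.sum_nonpos fun k _ => ?_
      by_cases hk : 0 < lam k
      · simp [hd, hpos k hk]
      · exact mul_nonpos_of_nonpos_of_nonneg (not_lt.1 hk) (by positivity)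
    linarith
  have hneg : F u v < 0 := by
    refine lt_of_le_of_ne ?_ huv
    have := hpolar m ⟨u, v, fun i => rfl⟩
    rw [hFm]
    linarith
  have hm0 : ∀ i, m i ≠ 0 := by
    have h1 := huv
    rw [hF] at h1
    exact fun i => Finset.prod_ne_zero_iff.1 h1 i (Finset.mem_univ i)
  refine ⟨F u v, (e 0 / m 0 + e 1 / m 1 + e 2 / m 2 + e 3 / m 3) / 4,
    (f 0 / m 0 + f 1 / m 1 + f 2 / m 2 + f 3 / m 3) / 4, fun x y => ?_⟩
  set c := (e 0 / m 0 + e 1 / m 1 + e 2 / m 2 + e 3 / m 3) / 4 * x +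
    (f 0 / m 0 + f 1 / m 1 + f 2 / m 2 + f 3 / m 3) / 4 * y with hc
  set s : Fin 4 → ℝ := fun i => (e i * x + f i * y) / m i - c with hsdef
  have hs : ∀ i, e i * x + f i * y = m i * (s i + c) := by
    intro i
    have := hm0 i
    simp only [hsdef]
    field_simp
    ring
  have hsum : s 0 + s 1 + s 2 + s 3 = 0 := by
    simp only [hsdef, hc]
    ring
  clear_value c s
  have hp := hpolar (fun i => m i * s i) ⟨x - c * u, y - c * v, fun i => by
    have := hs i
    simp only [hm] at this ⊢
    linear_combination -this⟩
  have he2 : 0 ≤ s 2 * s 3 + s 1 * s 3 + s 1 * s 2 + s 0 * s 3 + s 0 * s 2 + s 0 * s 1 := by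
    by_contra! hlt
    have := mul_pos_of_neg_of_neg hneg hlt
    rw [hFm] at this
    linarith
  have hsq : s 0 ^ 2 + s 1 ^ 2 + s 2 ^ 2 + s 3 ^ 2 ≤ 0 := by
    have : (s 0 + s 1 + s 2 + s 3) ^ 2 = 0 := by rw [hsum]; ring
    linarith
  have hz : ∀ i, s i = 0 := by
    have h0 : ∑ i, s i ^ 2 ≤ 0 := by rwa [Fin.sum_univ_four]
    have h1 := (Finset.sum_eq_zero_iff_of_nonneg fun i _ => sq_nonneg (s i)).1
      (h0.antisymm (Finset.sum_nonneg fun i _ => sq_nonneg (s i)))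
    exact fun i => pow_eq_zero_iff two_ne_zero |>.1 (h1 i (Finset.mem_univ i))
  rw [hFm, hF, Fin.prod_univ_four, hs 0, hs 1, hs 2, hs 3, hz 0, hz 1, hz 2, hz 3]
  ring

lemma two_le_card_pos {ι : Type*} [Fintype ι] {F : ℝ → ℝ → ℝ}
    {lam α β : ι → ℝ} (hlam : ∀ k, lam k ≠ 0) (hi : PairwiseIndep α β)
    (h : IsPowerSum F lam α β) {e f : Fin 4 → ℝ}
    (hF : ∀ x y, F x y = ∏ i, (e i * x + f i * y)) (hF4 : ¬ IsFourthPower F) :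
    2 ≤ Nat.card {k // 0 < lam k} := by
  by_contra! hlt
  have hsub : Subsingleton {k // 0 < lam k} :=
    Finite.card_le_one_iff_subsingleton.1 (Nat.lt_succ_iff.1 hlt)
  obtain ⟨u, v, huv, hpos⟩ := exists_ne_zero_of_pos_coeff_subsingleton hlam hi h hF4
    fun k l hk hl => congrArg Subtype.val (Subsingleton.elim (⟨k, hk⟩ : {k // 0 < lam k}) ⟨l, hl⟩)
  exact hF4 (isFourthPower_of_pos_coeff_vanish h hF huv hpos)

lemma two_le_card_neg {ι : Type*} [Fintype ι] {F : ℝ → ℝ → ℝ}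
    {lam α β : ι → ℝ} (hlam : ∀ k, lam k ≠ 0) (hi : PairwiseIndep α β)
    (h : IsPowerSum F lam α β) {e f : Fin 4 → ℝ}
    (hF : ∀ x y, F x y = ∏ i, (e i * x + f i * y)) (hF4 : ¬ IsFourthPower F) :
    2 ≤ Nat.card {k // lam k < 0} := by
  have := two_le_card_pos (F := fun x y => -F x y) (lam := -lam) (α := α) (β := β)
    (e := fun i => if i = 0 then -e i else e i) (f := fun i => if i = 0 then -f i else f i)
    (fun k => neg_ne_zero.2 (hlam k)) hi (fun x y => by simp [h x y]) (fun x y => by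
      simp [hF, Fin.prod_univ_four]
      ring) (fun ⟨k, m, n, hk⟩ => hF4 ⟨-k, m, n, fun x y => by linarith [hk x y]⟩)
  simpa using this

/-- A function with a power sum representation having two positive and two negative
coefficients. -/
def HasTwoTwoRep (F : ℝ → ℝ → ℝ) : Prop :=
  ∃ lam α β : Fin 4 → ℝ, PairwiseIndep α β ∧ IsPowerSum F lam α β ∧
    0 < lam 0 ∧ 0 < lam 1 ∧ lam 2 < 0 ∧ lam 3 < 0

lemma HasTwoTwoRep.comp_linear {F : ℝ → ℝ → ℝ} (h : HasTwoTwoRep F) {P Q R S : ℝ}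
    (hd : P * S - Q * R ≠ 0) :
    HasTwoTwoRep fun x y => F (P * x + Q * y) (R * x + S * y) := by
  obtain ⟨lam, α, β, hi, h, hl⟩ := h
  exact ⟨lam, _, _, hi.comp_linear hd, h.comp_linear P Q R S, hl⟩

lemma HasTwoTwoRep.neg {F : ℝ → ℝ → ℝ} (h : HasTwoTwoRep F) :
    HasTwoTwoRep fun x y => -F x y := by
  obtain ⟨lam, α, β, hi, h, h0, h1, h2, h3⟩ := h
  let σ : Equiv.Perm (Fin 4) := Equiv.addRight 2
  refine ⟨fun k => -lam (σ k), fun k => α (σ k), fun k => β (σ k),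
    fun k l hkl => hi _ _ fun hh => hkl (σ.injective hh), fun x y => ?_,
    neg_pos.2 h2, neg_pos.2 h3, neg_lt_zero.2 h0, neg_lt_zero.2 h1⟩
  simp only [neg_mul, Finset.sum_neg_distrib]
  rw [h, Equiv.sum_comp σ fun k => lam k * (α k * x + β k * y) ^ 4]

lemma HasTwoTwoRep.const_mul {F : ℝ → ℝ → ℝ} (h : HasTwoTwoRep F) {c : ℝ} (hc : c ≠ 0) :
    HasTwoTwoRep fun x y => c * F x y := by
  wlog hpos : 0 < c generalizing c
  · have := (this (neg_ne_zero.2 hc)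
      (neg_pos.2 (lt_of_le_of_ne (not_lt.1 hpos) hc))).neg
    simpa using this
  obtain ⟨lam, α, β, hi, h, h0, h1, h2, h3⟩ := h
  refine ⟨fun k => c * lam k, α, β, hi, fun x y => ?_, by positivity, by positivity,
    mul_neg_of_pos_of_neg hpos h2, mul_neg_of_pos_of_neg hpos h3⟩
  simp only [mul_assoc, ← Finset.mul_sum]
  rw [h]

lemma hasTwoTwoRep_cube_mul : HasTwoTwoRep fun x y => x ^ 3 * y := by
  refine ⟨![8 / 48, 1 / 48, -8 / 48, -1 / 48], ![1, 1, 1, 1], ![1, -2, -1, 2], ?_, ?_, ?_⟩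
  · intro k l hkl
    fin_cases k <;> fin_cases l <;> simp at hkl ⊢ <;> norm_num
  · intro x y
    simp only [Fin.sum_univ_four]
    simp
    ring
  · simp
    norm_num

lemma hasTwoTwoRep_of_diagonal {α β γ δ : ℝ} (h₁ : α * β ≤ 0) (h₂ : γ * δ ≤ 0)
    (hF : ¬ IsFourthPower fun x y => (α * x ^ 2 + β * y ^ 2) * (γ * x ^ 2 + δ * y ^ 2)) :
    HasTwoTwoRep fun x y => (α * x ^ 2 + β * y ^ 2) * (γ * x ^ 2 + δ * y ^ 2) := by
  have hw : α * δ + β * γ ≠ 0 := by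
    intro h0
    have hprod : 0 ≤ (α * δ) * (β * γ) := by nlinarith [mul_nonneg_of_nonpos_of_nonpos h₁ h₂]
    have had : α * δ = 0 := by nlinarith [sq_nonneg (α * δ)]
    have hbc : β * γ = 0 := by linarith
    apply hF
    rcases mul_eq_zero.1 had with rfl | rfl <;> rcases mul_eq_zero.1 hbc with rfl | rfl
    · exact ⟨0, 0, 0, fun x y => by ring⟩
    · exact ⟨β * δ, 0, 1, fun x y => by ring⟩
    · exact ⟨α * γ, 1, 0, fun x y => by ring⟩
    · exact ⟨0, 0, 0, fun x y => by ring⟩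
  wlog hpos : 0 < α * δ + β * γ generalizing α β
  · have := (this (α := -α) (β := -β) (by linarith) (fun ⟨k, m, n, hk⟩ => hF
      ⟨-k, m, n, fun x y => by linarith [hk x y]⟩) (fun h => hw (by linarith))
      (by
        have := lt_of_le_of_ne (not_lt.1 hpos) hw
        linarith)).neg
    convert this using 3
    ring
  have hu : α * γ ≤ 0 := by
    by_contra! h
    nlinarith [mul_pos h hpos, mul_nonneg (sq_nonneg α) (neg_nonneg.2 h₂),
      mul_nonneg (sq_nonneg γ) (neg_nonneg.2 h₁)]
  have hv : β * δ ≤ 0 := by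
    by_contra! h
    nlinarith [mul_pos h hpos, mul_nonneg (sq_nonneg β) (neg_nonneg.2 h₂),
      mul_nonneg (sq_nonneg δ) (neg_nonneg.2 h₁)]
  set w := (α * δ + β * γ) / 6 with hwdef
  have hw0 : 0 < w := by positivity
  refine ⟨![w / 2, w / 2, α * γ - w, β * δ - w], ![1, 1, 1, 0], ![1, -1, 0, 1], ?_, ?_, ?_⟩
  · intro k l hkl
    fin_cases k <;> fin_cases l <;> simp at hkl ⊢
    norm_num
  · intro x y
    simp only [Fin.sum_univ_four]
    simp [hwdef]
    ring
  · simp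
    refine ⟨hw0, ?_, ?_⟩ <;> linarith

lemma mul_nonpos_of_diagonal_zero {α β x y : ℝ} (h : α * x ^ 2 + β * y ^ 2 = 0)
    (hxy : x ≠ 0 ∨ y ≠ 0) : α * β ≤ 0 := by
  by_contra! hlt
  have h1 : (α * x) ^ 2 + α * β * y ^ 2 = 0 := by linear_combination α * h
  have h2 : (β * y) ^ 2 + α * β * x ^ 2 = 0 := by linear_combination β * h
  rcases hxy with hx | hy
  · have : 0 < α * β * x ^ 2 := by positivity
    nlinarith [sq_nonneg (β * y)]
  · have : 0 < α * β * y ^ 2 := by positivity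
    nlinarith [sq_nonneg (α * x)]

lemma hasTwoTwoRep_of_definite_pencil {r₁ r₂ r₃ r₄ A B : ℝ} (hA : A ≠ 0) (hAB : 0 < A + B)
    (hdef : (A * (r₁ + r₂) + B * (r₃ + r₄)) ^ 2 < 4 * (A + B) * (A * (r₁ * r₂) + B * (r₃ * r₄)))
    (hF : ¬ IsFourthPower fun x y =>
      (x - r₁ * y) * (x - r₂ * y) * ((x - r₃ * y) * (x - r₄ * y))) :
    HasTwoTwoRep fun x y => (x - r₁ * y) * (x - r₂ * y) * ((x - r₃ * y) * (x - r₄ * y)) := by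
  obtain ⟨P, Q, R, S, s, t, hd, hb, hc⟩ := exists_simultaneous_diagonalization hAB
    (b₁ := -(A * (r₁ + r₂) + B * (r₃ + r₄))) (b₂ := A * (r₁ * r₂) + B * (r₃ * r₄))
    (by linarith) 1 (-(r₃ + r₄)) (r₃ * r₄)
  have hq₂ : ∀ x y, (x - r₃ * y) * (x - r₄ * y) =
      s * (P * x + Q * y) ^ 2 + t * (R * x + S * y) ^ 2 := by
    intro x y
    rw [← hc]
    ring
  have hq₁ : ∀ x y, (x - r₁ * y) * (x - r₂ * y) =
      (1 - B * s) / A * (P * x + Q * y) ^ 2 + (1 - B * t) / A * (R * x + S * y) ^ 2 := by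
    intro x y
    field_simp
    linear_combination hb x y - B * hc x y
  have hne : ∀ r : ℝ, P * r + Q * 1 ≠ 0 ∨ R * r + S * 1 ≠ 0 := by
    intro r
    by_contra! hz
    refine hd ?_
    linear_combination P * hz.2 - R * hz.1
  have hst := mul_nonpos_of_diagonal_zero ((hq₂ r₃ 1).symm.trans (by ring)) (hne r₃)
  have hst' := mul_nonpos_of_diagonal_zero ((hq₁ r₁ 1).symm.trans (by ring)) (hne r₁)
  have hG := hasTwoTwoRep_of_diagonal hst' hst fun h4 => hF (by
    simpa only [hq₁, hq₂] using h4.comp_linear P Q R S)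
  simpa only [hq₁, hq₂] using hG.comp_linear hd

lemma hasTwoTwoRep_of_sorted_roots {r₁ r₂ r₃ r₄ : ℝ} (h₁₂ : r₁ ≤ r₂) (h₂₃ : r₂ ≤ r₃)
    (h₃₄ : r₃ ≤ r₄) (hF : ¬ IsFourthPower fun x y =>
      (x - r₁ * y) * (x - r₂ * y) * ((x - r₃ * y) * (x - r₄ * y))) :
    HasTwoTwoRep fun x y => (x - r₁ * y) * (x - r₂ * y) * ((x - r₃ * y) * (x - r₄ * y)) := by
  rcases h₂₃.lt_or_eq with h | rfl
  · obtain ⟨d, rfl⟩ : ∃ d, r₂ = r₁ + 2 * d := ⟨(r₂ - r₁) / 2, by ring⟩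
    obtain ⟨e, rfl⟩ : ∃ e, r₄ = r₃ + 2 * e := ⟨(r₄ - r₃) / 2, by ring⟩
    obtain ⟨g, rfl⟩ : ∃ g, r₃ = r₁ + 2 * d + 2 * g := ⟨(r₃ - (r₁ + 2 * d)) / 2, by ring⟩
    have hd : 0 ≤ d := by linarith
    have he : 0 ≤ e := by linarith
    have hg : 0 < g := by linarith
    refine hasTwoTwoRep_of_definite_pencil (A := e + g) (B := d + g) (by positivity)
      (by positivity) ?_ hF
    have : 0 < 4 * (d + e + 2 * g) * ((e + g) * (g * (2 * d + g)) + (d + g) * (g * (2 * e + g))) :=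
      by positivity
    linear_combination this
  rcases h₁₂.lt_or_eq with h1 | rfl
  · rcases h₃₄.lt_or_eq with h2 | rfl
    · obtain ⟨u, rfl⟩ : ∃ u, r₁ = r₂ - u := ⟨r₂ - r₁, by ring⟩
      obtain ⟨v, rfl⟩ : ∃ v, r₄ = r₂ + v := ⟨r₄ - r₂, by ring⟩
      have hu : 0 < u := by linarith
      have hv : 0 < v := by linarith
      have hperm : (fun x y : ℝ => (x - (r₂ - u) * y) * (x - r₂ * y) *
          ((x - r₂ * y) * (x - (r₂ + v) * y))) = fun x y => (x - r₂ * y) * (x - r₂ * y) *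
          ((x - (r₂ - u) * y) * (x - (r₂ + v) * y)) := by
        ext x y
        ring
      rw [hperm] at hF ⊢
      refine hasTwoTwoRep_of_definite_pencil (A := u * v + u ^ 2 + v ^ 2) (B := -(u * v))
        (by positivity) (by nlinarith [sq_nonneg u, sq_nonneg v, pow_pos hu 2]) ?_ hF
      have : 0 < u * v * (u * v * (4 * (u ^ 2 + v ^ 2) - (u - v) ^ 2)) := by
        have : 0 < 4 * (u ^ 2 + v ^ 2) - (u - v) ^ 2 := by
          nlinarith [mul_pos hu hv, pow_pos hu 2, pow_pos hv 2]
        positivity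
      linear_combination this
    · have := hasTwoTwoRep_cube_mul.comp_linear (P := 1) (Q := -r₂) (R := 1) (S := -r₁)
        (by intro h; linarith)
      convert this using 3
      ring
  · rcases h₃₄.lt_or_eq with h2 | rfl
    · have := hasTwoTwoRep_cube_mul.comp_linear (P := 1) (Q := -r₁) (R := 1) (S := -r₄)
        (by intro h; linarith)
      convert this using 3
      ring
    · exact absurd ⟨1, 1, -r₁, fun x y => by ring⟩ hF

lemma hasTwoTwoRep_of_splits {F : ℝ → ℝ → ℝ} {e f : Fin 4 → ℝ}
    (hF : ∀ x y, F x y = ∏ i, (e i * x + f i * y)) (hF4 : ¬ IsFourthPower F) :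
    HasTwoTwoRep F := by
  obtain ⟨u, v, huv⟩ : ∃ u v, F u v ≠ 0 := by
    by_contra! hz
    exact hF4 ⟨0, 0, 0, fun x y => by simp [hz]⟩
  set m : Fin 4 → ℝ := fun i => e i * u + f i * v with hm
  have hm0 : ∀ i, m i ≠ 0 := by
    have h1 := huv
    rw [hF] at h1
    exact fun i => Finset.prod_ne_zero_iff.1 h1 i (Finset.mem_univ i)
  have hN : u ^ 2 + v ^ 2 ≠ 0 := by
    intro h0
    have hu : u = 0 := by nlinarith [sq_nonneg u, sq_nonneg v]
    have hv : v = 0 := by nlinarith [sq_nonneg u, sq_nonneg v]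
    apply hm0 0
    simp [hm, hu, hv]
  set N := u ^ 2 + v ^ 2 with hNdef
  let ρ : Fin 4 → ℝ := fun i => (e i * v - f i * u) / m i
  let σ := Tuple.sort ρ
  have hmono : Monotone (ρ ∘ σ) := Tuple.monotone_sort ρ
  let G : ℝ → ℝ → ℝ := fun x y => (x - ρ (σ 0) * y) * (x - ρ (σ 1) * y) *
    ((x - ρ (σ 2) * y) * (x - ρ (σ 3) * y))
  have hFG : F = fun x y => F u v * G (u / N * x + v / N * y) (-v / N * x + u / N * y) := by
    ext x y
    have h1 : ∀ i, e i * x + f i * y = m i *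
        ((u / N * x + v / N * y) - ρ i * (-v / N * x + u / N * y)) := by
      intro i
      have := hm0 i
      simp only [ρ]
      field_simp
      simp only [hm, hNdef]
      ring
    have h2 : ∀ X Y, G X Y = ∏ i, (X - ρ i * Y) := by
      intro X Y
      rw [← Equiv.prod_comp σ fun i => X - ρ i * Y, Fin.prod_univ_four]
      simp only [G]
      ring
    rw [h2, hF x y, hF u v, ← Finset.prod_mul_distrib]
    exact Finset.prod_congr rfl fun i _ => h1 i
  have hG4 : ¬ IsFourthPower G := by
    intro hG
    obtain ⟨k, a, b, hk⟩ := hG.comp_linear (u / N) (v / N) (-v / N) (u / N)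
    refine hF4 ⟨F u v * k, a, b, fun x y => ?_⟩
    rw [mul_assoc, ← hk]
    exact congrFun (congrFun hFG x) y
  have hG : HasTwoTwoRep G := hasTwoTwoRep_of_sorted_roots (hmono (by decide : (0 : Fin 4) ≤ 1))
    (hmono (by decide : (1 : Fin 4) ≤ 2)) (hmono (by decide : (2 : Fin 4) ≤ 3)) hG4
  have hdet : u / N * (u / N) - v / N * (-v / N) ≠ 0 := by
    have : u / N * (u / N) - v / N * (-v / N) = 1 / N := by
      field_simp
      rw [hNdef]
      ring
    rw [this]
    exact one_div_ne_zero hN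
  rw [hFG]
  exact (hG.comp_linear hdet).const_mul huv

lemma HasTwoTwoRep.mem_badges {p : MvPolynomial (Fin 2) ℝ}
    (h : HasTwoTwoRep fun x y => eval ![x, y] p) : (2, 2) ∈ badges 2 p := by
  classical
  obtain ⟨lam, α, β, hi, h, h0, h1, h2, h3⟩ := h
  have hmem := mem_badges_of_isPowerSum hi h
  have hp : Nat.card {k // 0 < lam k} = 2 := by
    rw [Nat.card_eq_fintype_card, Fintype.card_subtype]
    have : Finset.univ.filter (fun k => 0 < lam k) = {0, 1} := by
      ext k
      fin_cases k <;> simp [h0, h1, h2.le, h3.le]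
    rw [this]
    rfl
  have hn : Nat.card {k // lam k < 0} = 2 := by
    rw [Nat.card_eq_fintype_card, Fintype.card_subtype]
    have : Finset.univ.filter (fun k => lam k < 0) = {2, 3} := by
      ext k
      fin_cases k <;> simp [h0.le, h1.le, h2, h3]
    rw [this]
    rfl
  rwa [hp, hn] at hmem

lemma eq_or_eq_neg_pow_four {p : MvPolynomial (Fin 2) ℝ}
    (h : IsFourthPower fun x y => eval ![x, y] p) :
    ∃ c d : ℝ, p = (c • X 0 + d • X 1 : MvPolynomial (Fin 2) ℝ) ^ 4 ∨
      p = -(c • X 0 + d • X 1 : MvPolynomial (Fin 2) ℝ) ^ 4 := by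
  obtain ⟨k, m, n, h⟩ := h
  have hroot : √√|k| ^ 4 = |k| := by
    rw [show √√|k| ^ 4 = (√√|k| ^ 2) ^ 2 by ring, Real.sq_sqrt (Real.sqrt_nonneg _),
      Real.sq_sqrt (abs_nonneg k)]
  refine ⟨√√|k| * m, √√|k| * n, ?_⟩
  rcases le_total 0 k with hk | hk
  · rw [abs_of_nonneg hk] at hroot ⊢
    refine Or.inl (eq_of_eval_eq fun x y => (h x y).trans ?_)
    simp [smul_eval]
    linear_combination (-(m * x + n * y) ^ 4) * hroot
  · rw [abs_of_nonpos hk] at hroot ⊢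
    refine Or.inr (eq_of_eval_eq fun x y => (h x y).trans ?_)
    simp [smul_eval]
    linear_combination ((m * x + n * y) ^ 4) * hroot

theorem isSignature_two_two_of_splits {p : MvPolynomial (Fin 2) ℝ} {e f : Fin 4 → ℝ}
    (hp : p = ∏ i : Fin 4, (e i • X 0 + f i • X 1 : MvPolynomial (Fin 2) ℝ))
    (hp4 : ¬ ∃ c d : ℝ, p = (c • X 0 + d • X 1 : MvPolynomial (Fin 2) ℝ) ^ 4 ∨
      p = -(c • X 0 + d • X 1 : MvPolynomial (Fin 2) ℝ) ^ 4) :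
    IsSignature 2 p (2, 2) := by
  have hF : ∀ x y, eval ![x, y] p = ∏ i, (e i * x + f i * y) := by
    intro x y
    rw [hp]
    simp [map_prod, smul_eval]
  have hF4 := mt eq_or_eq_neg_pow_four hp4
  refine ⟨(hasTwoTwoRep_of_splits hF hF4).mem_badges, ?_⟩
  rintro ⟨c, d⟩ ⟨r, lam, α, β, hrep, rfl, rfl⟩ h1 h2
  have h := isPowerSum_of_isHonestRep hrep
  exact Prod.ext (le_antisymm h1 (two_le_card_pos hrep.1 hrep.2.1 h hF hF4))
    (le_antisymm h2 (two_le_card_neg hrep.1 hrep.2.1 h hF hF4))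

theorem stmt15 (a : ℕ → ℝ) (p : MvPolynomial (Fin 2) ℝ)
    (hp : p = ∑ j ∈ Finset.range 5,
      ((Nat.choose 4 j : ℝ) * a j) • ((X 0 : MvPolynomial (Fin 2) ℝ) ^ (4-j) * X 1 ^ j))
    (A : Matrix (Fin 3) (Fin 3) ℝ)
    (hA : A = Matrix.of fun i j : Fin 3 => a ((i:ℕ)+(j:ℕ)))
    (hAh : A.IsHermitian) :
    ((∃ (b0 b1 b2 : ℝ) (q : MvPolynomial (Fin 2) ℝ), b1^2 - 4*b0*b2 < 0 ∧
        p = (b0 • (X 0 : MvPolynomial (Fin 2) ℝ)^2 + b1 • (X 0 * X 1) + b2 • X 1^2) * q) →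
      IsSignature 2 p
        (Nat.card {i // 0 < hAh.eigenvalues i}, Nat.card {i // hAh.eigenvalues i < 0})) ∧
    ((∃ e f : Fin 4 → ℝ, (∀ i, (e i, f i) ≠ (0, 0)) ∧
        p = ∏ i : Fin 4, (e i • X 0 + f i • X 1 : MvPolynomial (Fin 2) ℝ)) →
      (¬ ∃ c d : ℝ, p = (c • X 0 + d • X 1 : MvPolynomial (Fin 2) ℝ)^4 ∨
        p = -(c • X 0 + d • X 1 : MvPolynomial (Fin 2) ℝ)^4) →
      IsSignature 2 p (2, 2)) := by
  have hpe : ∀ x y, eval ![x, y] p = quarticForm a x y := by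
    intro x y
    rw [hp]
    simp [Finset.sum_range_succ, smul_eval, quarticForm, Nat.choose]
    ring
  refine ⟨?_, ?_⟩
  · rintro ⟨b₀, b₁, b₂, q, hb, hq⟩
    exact isSignature_of_definite_factor hpe hA hAh hb hq
  · rintro ⟨e, f, -, hef⟩ hp4
    exact isSignature_two_two_of_splits hef hp4
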